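/- For every partial computable information content measure I there exist a constant c ∈ ℕ and a single partial computable function F from ℕ × (binary strings) to binary strings such that: for every binary stream X with I(X↾n) defined for all n, there exists a Martin-Löf random binary stream Y such that F(n, Y↾(c + min_{i≥n} I(X↾i))) = X↾n for every n. -/

import Mathlib

open scoped ENNReal

abbrev BStr := List Bool

/-- The first `n` bits of the stream `X`, as a binary string. -/
def stake (X : ℕ → Bool) (n : ℕ) : BStr := (List.range n).map X

/-- A set of binary strings is prefix-free if no element is a proper prefix of another. -/
def PrefixFreeSet (S : Set BStr) : Prop :=
  ∀ σ ∈ S, ∀ τ ∈ S, σ <+: τ → σ = τ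

/-- `X` is computable from `Y` with oracle-use `f`. -/
def ComputableWithUse (X Y : ℕ → Bool) (f : ℕ → ℕ) : Prop :=
  ∃ F : ℕ × BStr →. BStr, Partrec F ∧ ∀ n, stake X n ∈ F (n, stake Y (f n))

/-- A prefix-free machine: partial computable with prefix-free domain. -/
def PrefixFreeMachine (M : BStr →. BStr) : Prop :=
  Partrec M ∧ PrefixFreeSet {ρ | (M ρ).Dom}

/-- `K_M σ`: least length of an `M`-description of `σ` (`⊤` if none). -/
noncomputable def KM (M : BStr →. BStr) (σ : BStr) : ℕ∞ :=
  sInf ((fun ρ : BStr => (ρ.length : ℕ∞)) '' {ρ | σ ∈ M ρ})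

/-- Universal prefix-free machine. -/
def UniversalPFM (U : BStr →. BStr) : Prop :=
  PrefixFreeMachine U ∧
    ∀ M : BStr →. BStr, PrefixFreeMachine M →
      ∃ c : ℕ, ∀ σ, KM U σ ≤ KM M σ + (c : ℕ∞)

/-- Prefix-free Kolmogorov complexity w.r.t. `U`, as a natural number. -/
noncomputable def Kof (U : BStr →. BStr) (σ : BStr) : ℕ := (KM U σ).toNat

/-- Martin-Löf randomness via Schnorr's characterization: `K(Y↾n) ≥ n - c`. -/
def MLRandom (U : BStr →. BStr) (Y : ℕ → Bool) : Prop :=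
  ∃ c : ℕ, ∀ n, n ≤ Kof U (stake Y n) + c

/-- The weight `2^{-I(σ)}` contributed by `σ` (zero if `I σ` is undefined). -/
noncomputable def iweight (I : BStr →. ℕ) (σ : BStr) : ℝ≥0∞ :=
  haveI := Classical.propDecidable (I σ).Dom
  if h : (I σ).Dom then ((2 : ℝ≥0∞) ^ ((I σ).get h))⁻¹ else 0

/-! ### Computability tools -/

/-- The range of a partial computable function has a primitive recursive enumeration
in which every value occurs infinitely often. -/
theorem Partrec.exists_enum {α β : Type*} [Primcodable α] [Primcodable β] {g : α →. β}
    (hg : Partrec g) :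
    ∃ e : ℕ → Option β, Primrec e ∧ (∀ s b, b ∈ e s → ∃ a, b ∈ g a) ∧
      ∀ a b, b ∈ g a → ∀ M, ∃ s, M ≤ s ∧ b ∈ e s := by
  obtain ⟨cd, hcd⟩ := Nat.Partrec.Code.exists_code.1 hg
  refine ⟨fun s => (Nat.Partrec.Code.evaln s.unpair.1 cd s.unpair.2).bind Encodable.decode,
    ?_, ?_, ?_⟩
  · refine Primrec.option_bind ?_ (Primrec.decode.comp Primrec.snd).to₂
    exact Nat.Partrec.Code.primrec_evaln.comp
      (((Primrec.fst.comp Primrec.unpair).pair (Primrec.const cd)).pair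
        (Primrec.snd.comp Primrec.unpair))
  · intro s b hb
    obtain ⟨r, hr, hb⟩ := Option.mem_bind_iff.1 hb
    have h := Nat.Partrec.Code.evaln_sound hr
    rw [hcd] at h
    obtain ⟨a, -, h⟩ := Part.mem_bind_iff.1 h
    obtain ⟨b', hb', rfl⟩ := (Part.mem_map_iff _).1 h
    rw [Option.mem_def, Encodable.encodek, Option.some_inj] at hb
    exact ⟨a, hb ▸ hb'⟩
  · intro a b hb M
    have h : Encodable.encode b ∈ Nat.Partrec.Code.eval cd (Encodable.encode a) := by
      rw [hcd]
      simpa using hb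
    obtain ⟨k, hk⟩ := Nat.Partrec.Code.evaln_complete.1 h
    refine ⟨Nat.pair (max k M) (Encodable.encode a),
      (le_max_right _ _).trans (Nat.left_le_pair _ _), ?_⟩
    have := Nat.Partrec.Code.evaln_mono (le_max_left k M) hk
    simp only [Nat.unpair_pair, Option.mem_def] at this ⊢
    simp [this]

theorem PrimrecPred.forall_mem {α β : Type*} [Primcodable α] [Primcodable β]
    {f : α → List β} {R : α → β → Prop} (hR : PrimrecRel R) (hf : Primrec f) :
    PrimrecPred fun a => ∀ b ∈ f a, R a b :=
  (PrimrecRel.forall_mem_list hR.swap).comp hf Primrec.id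

theorem PrimrecPred.exists_mem {α β : Type*} [Primcodable α] [Primcodable β]
    {f : α → List β} {R : α → β → Prop} (hR : PrimrecRel R) (hf : Primrec f) :
    PrimrecPred fun a => ∃ b ∈ f a, R a b :=
  (PrimrecRel.exists_mem_list hR.swap).comp hf Primrec.id

theorem PrimrecRel.isPrefix {α : Type*} [Primcodable α] :
    PrimrecRel fun l₁ l₂ : List α => l₁ <+: l₂ :=
  ((Primrec.eq (α := List α)).comp Primrec.fst
    (Primrec.list_take.comp (Primrec.list_length.comp Primrec.fst) Primrec.snd)).of_eq fun p => by
      exact List.prefix_iff_eq_take.symm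

theorem PrimrecRel.mem {α : Type*} [Primcodable α] :
    PrimrecRel fun (a : α) (l : List α) => a ∈ l :=
  (PrimrecPred.exists_mem (f := Prod.snd) (R := fun (p : α × List α) b => b = p.1)
    (Primrec.eq.comp Primrec.snd (Primrec.fst.comp Primrec.fst)) Primrec.snd).of_eq fun p => by
      simp

/-! ### The coding step -/

/-- All binary strings of length `N`. -/
def strs : ℕ → List BStr
  | 0 => [[]]
  | N + 1 => (strs N).flatMap fun y => [false :: y, true :: y]

theorem mem_strs {N : ℕ} {y : BStr} : y ∈ strs N ↔ y.length = N := by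
  induction N generalizing y with
  | zero => simp [strs]
  | succ N ih =>
    rcases y with _ | ⟨b, y⟩
    · simp [strs]
    · cases b <;> simp [strs, ih]

theorem primrec_strs : Primrec strs := by
  have : Primrec₂ fun (_ : ℕ) (L : List BStr) =>
      L.flatMap fun y => [false :: y, true :: y] := by
    refine Primrec.list_flatMap Primrec.snd ?_
    exact Primrec.list_cons.comp (Primrec.list_cons.comp (Primrec.const _) Primrec.snd)
      (Primrec.list_cons.comp (Primrec.list_cons.comp (Primrec.const _) Primrec.snd)
        (Primrec.const _))
  refine (Primrec.nat_rec₁ [[]] this).of_eq fun N => ?_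
  induction N with
  | zero => rfl
  | succ N ih => simp only [ih, strs]

/-- `ρ` has an extension of length `N` that avoids `B` and has no code of `f` longer than `ρ`
as a prefix. -/
def IsOpenCode (f : List (BStr × BStr)) (B : List BStr) (N : ℕ) (ρ : BStr) : Prop :=
  ∃ y ∈ strs N, ρ <+: y ∧ (∀ b ∈ B, ¬ b <+: y) ∧ ∀ q ∈ f, q.1 <+: y → q.1.length ≤ ρ.length

/-- The prefixes of `y` may serve as codes for the pairs (string, level) in `l`. -/
def ValidCode (c N : ℕ) (B : List BStr) (l : List (BStr × ℕ)) (f : List (BStr × BStr))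
    (y : BStr) : Prop :=
  (∀ b ∈ B, ¬ b <+: y) ∧ ∀ p ∈ l, c + p.2 ≤ N ∧
    ((y.take (c + p.2), p.1) ∈ f ∨
      (∀ q ∈ f, q.1 ≠ y.take (c + p.2)) ∧ ∀ q ∈ f, q.2 = p.1 → ¬ IsOpenCode f B N q.1)

open Classical in
/-- Add the codes given by the first valid string of length `N`, if there is one. -/
noncomputable def codeStep (c N : ℕ) (B : List BStr) (l : List (BStr × ℕ))
    (f : List (BStr × BStr)) : List (BStr × BStr) :=
  (((strs N).filter fun y => ValidCode c N B l f y).head?.map fun y =>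
    l.map fun p => (y.take (c + p.2), p.1)).getD [] ++ f

section
open Primrec

theorem primrec_isOpenCode :
    PrimrecPred fun a : (List (BStr × BStr) × List BStr × ℕ) × BStr =>
      IsOpenCode a.1.1 a.1.2.1 a.1.2.2 a.2 := by
  unfold IsOpenCode
  refine PrimrecPred.exists_mem ?_ (primrec_strs.comp (snd.comp (snd.comp fst)))
  refine PrimrecPred.and (PrimrecRel.isPrefix.comp (snd.comp fst) snd) (PrimrecPred.and ?_ ?_)
  · refine PrimrecPred.forall_mem ?_ (fst.comp (snd.comp (fst.comp fst)))
    exact (PrimrecRel.isPrefix.comp snd (snd.comp fst)).not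
  · refine PrimrecPred.forall_mem ?_ (fst.comp (fst.comp fst))
    refine ((PrimrecPred.not (PrimrecRel.isPrefix.comp (fst.comp snd) (snd.comp fst))).or
      (nat_le.comp (list_length.comp (fst.comp snd))
        (list_length.comp (snd.comp (fst.comp fst))))).of_eq fun a => ?_
    exact imp_iff_not_or.symm

theorem primrec_validCode (c : ℕ) :
    PrimrecRel fun (y : BStr) (a : (List (BStr × ℕ) × List (BStr × BStr)) × List BStr × ℕ) =>
      ValidCode c a.2.2 a.2.1 a.1.1 a.1.2 y := by
  unfold ValidCode
  refine PrimrecPred.and ?_ ?_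
  · refine PrimrecPred.forall_mem ?_ (fst.comp (snd.comp snd))
    exact (PrimrecRel.isPrefix.comp snd (fst.comp fst)).not
  · refine PrimrecPred.forall_mem ?_ (fst.comp (fst.comp snd))
    have hk : Primrec fun p : (BStr × (List (BStr × ℕ) × List (BStr × BStr)) × List BStr × ℕ)
        × (BStr × ℕ) => c + p.2.2 := nat_add.comp (const c) (snd.comp snd)
    have ht : Primrec fun p : (BStr × (List (BStr × ℕ) × List (BStr × BStr)) × List BStr × ℕ)
        × (BStr × ℕ) => p.1.1.take (c + p.2.2) := list_take.comp hk (fst.comp fst)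
    have hf : Primrec fun p : (BStr × (List (BStr × ℕ) × List (BStr × BStr)) × List BStr × ℕ)
        × (BStr × ℕ) => p.1.2.1.2 := snd.comp (fst.comp (snd.comp fst))
    refine PrimrecPred.and (nat_le.comp hk (snd.comp (snd.comp (snd.comp fst))))
      (PrimrecPred.or (PrimrecRel.mem.comp (ht.pair (fst.comp snd)) hf) (PrimrecPred.and ?_ ?_))
    · refine PrimrecPred.forall_mem ?_ hf
      exact (Primrec.eq.comp (fst.comp snd) (ht.comp fst)).not
    · refine PrimrecPred.forall_mem ?_ hf
      refine ((PrimrecPred.not (Primrec.eq.comp (snd.comp snd) (fst.comp (snd.comp fst)))).or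
        (PrimrecPred.not (primrec_isOpenCode.comp (Primrec.pair (Primrec.pair (hf.comp fst)
          (snd.comp (snd.comp (fst.comp fst)))) (fst.comp snd))))).of_eq fun a => ?_
      exact imp_iff_not_or.symm

theorem primrec_codeStep (c : ℕ) :
    Primrec fun a : (List (BStr × ℕ) × List (BStr × BStr)) × List BStr × ℕ =>
      codeStep c a.2.2 a.2.1 a.1.1 a.1.2 := by
  classical
  unfold codeStep
  refine list_append.comp (option_getD.comp (option_map (list_head?.comp ?_) ?_) (const _))
    (snd.comp fst)
  · exact (PrimrecRel.listFilter (primrec_validCode c)).comp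
      (primrec_strs.comp (snd.comp snd)) Primrec.id
  · refine list_map (fst.comp (fst.comp fst)) ?_
    exact (list_take.comp (nat_add.comp (const c) (snd.comp snd)) (snd.comp fst)).pair
      (fst.comp snd)

end
/-! ### Chains of running minima -/

/-- The stack of those prefixes of `σ` of length less than `n` whose `I`-value is smaller than the
`I`-values of all longer ones, the longest prefix first. -/
def minStack (I : BStr →. ℕ) (σ : BStr) : ℕ → Part (List (BStr × ℕ))
  | 0 => Part.some []
  | n + 1 => (minStack I σ n).bind fun l =>
      (I (σ.take n)).map fun k => (σ.take n, k) :: l.filter fun q => q.2 < k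

/-- The stack of all prefixes of `σ`, including `σ`, that are strict minima of `I` among the longer
ones. -/
def minChain (I : BStr →. ℕ) (σ : BStr) : Part (List (BStr × ℕ)) :=
  minStack I σ (σ.length + 1)

theorem mem_minStack_succ {I : BStr →. ℕ} {σ : BStr} {n : ℕ} {l : List (BStr × ℕ)} :
    l ∈ minStack I σ (n + 1) ↔ ∃ l' ∈ minStack I σ n, ∃ k ∈ I (σ.take n),
      (σ.take n, k) :: l'.filter (fun q => q.2 < k) = l := by
  simp [minStack]

theorem partrec_minChain {I : BStr →. ℕ} (hI : Partrec I) : Partrec (minChain I) := by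
  have hg : Partrec₂ fun (σ : BStr) (p : ℕ × List (BStr × ℕ)) =>
      (I (σ.take p.1)).map fun k => (σ.take p.1, k) :: p.2.filter fun q => q.2 < k := by
    have ht : Computable fun a : BStr × ℕ × List (BStr × ℕ) => a.1.take a.2.1 :=
      (Primrec.list_take.comp (Primrec.fst.comp Primrec.snd) Primrec.fst).to_comp
    refine (hI.comp ht).map ?_
    refine Computable.list_cons.comp ((ht.comp Computable.fst).pair Computable.snd) ?_
    have hR : PrimrecRel fun (q : BStr × ℕ) (k : ℕ) => q.2 < k :=
      Primrec.nat_lt.comp (Primrec.snd.comp Primrec.fst) Primrec.snd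
    exact (hR.listFilter.comp (Primrec.snd.comp (Primrec.snd.comp Primrec.fst))
      Primrec.snd).to_comp
  refine (Partrec.nat_rec (f := fun σ : BStr => σ.length + 1) (g := fun _ => Part.some [])
    (Computable.succ.comp Computable.list_length) (Computable.const []).partrec hg).of_eq
      fun σ => ?_
  unfold minChain
  generalize σ.length + 1 = n
  induction n with
  | zero => rfl
  | succ n ih => simp only [minStack, ih]

theorem minStack_congr {I : BStr →. ℕ} {σ τ : BStr} {n : ℕ}
    (h : ∀ i < n, σ.take i = τ.take i) : minStack I σ n = minStack I τ n := by
  induction n with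
  | zero => rfl
  | succ n ih => simp only [minStack, ih fun i hi => h i (by omega), h n (by omega)]

theorem filter_lt_suffix {α : Type*} {l : List (α × ℕ)} (h : l.Pairwise fun p q => q.2 < p.2)
    (k : ℕ) : l.filter (fun q => q.2 < k) <:+ l := by
  induction l with
  | nil => simp
  | cons p l ih =>
    rw [List.pairwise_cons] at h
    by_cases hp : p.2 < k
    · rw [List.filter_eq_self.2]
      intro q hq
      rcases List.mem_cons.1 hq with rfl | hq
      · simpa using hp
      · simpa using (h.1 q hq).trans hp
    · rw [List.filter_cons_of_neg (by simpa using hp)]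
      exact (ih h.2).trans (List.suffix_cons p l)

/-- The properties of a list of (string, level) pairs that is a `minChain`. -/
structure IsMinChain (I : BStr →. ℕ) (l : List (BStr × ℕ)) : Prop where
  pairwise : l.Pairwise fun p q => q.2 < p.2
  mem : ∀ p ∈ l, p.2 ∈ I p.1
  suffix : ∀ p t, p :: t <:+ l → p :: t ∈ minChain I p.1

theorem isMinChain_of_mem_minStack {I : BStr →. ℕ} {σ : BStr} {n : ℕ} {l : List (BStr × ℕ)}
    (hn : n ≤ σ.length + 1) (hl : l ∈ minStack I σ n) : IsMinChain I l := by
  induction n generalizing l with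
  | zero =>
    obtain rfl : l = [] := by simpa [minStack] using hl
    exact ⟨by simp, by simp, by simp⟩
  | succ n ih =>
    have hl0 := hl
    obtain ⟨l', hl', k, hk, rfl⟩ := mem_minStack_succ.1 hl
    have h := ih (by omega) hl'
    have hs := filter_lt_suffix h.pairwise k
    refine ⟨?_, ?_, ?_⟩
    · rw [List.pairwise_cons]
      exact ⟨fun q hq => by simpa using (List.mem_filter.1 hq).2, h.pairwise.filter _⟩
    · intro p hp
      rcases List.mem_cons.1 hp with rfl | hp
      · exact hk
      · exact h.mem p (List.mem_filter.1 hp).1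
    · intro p t ht
      rcases List.suffix_cons_iff.1 ht with ht | ht
      · rw [ht]
        obtain ⟨rfl, -⟩ := List.cons.inj ht
        have hlen : (σ.take n).length = n := by rw [List.length_take]; omega
        rw [minChain, hlen]
        rw [minStack_congr (τ := σ)]
        · exact hl0
        · intro i hi
          rw [List.take_take]
          congr 1
          omega
      · exact h.suffix p t (ht.trans hs)

theorem isMinChain_of_mem_minChain {I : BStr →. ℕ} {σ : BStr} {l : List (BStr × ℕ)}
    (hl : l ∈ minChain I σ) : IsMinChain I l :=
  isMinChain_of_mem_minStack le_rfl hl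

theorem minStack_dom {I : BStr →. ℕ} {σ : BStr} {n : ℕ}
    (h : ∀ i < n, (I (σ.take i)).Dom) : ∃ l, l ∈ minStack I σ n := by
  induction n with
  | zero => exact ⟨[], by simp [minStack]⟩
  | succ n ih =>
    obtain ⟨l, hl⟩ := ih fun i hi => h i (by omega)
    exact ⟨_, mem_minStack_succ.2 ⟨l, hl, _, Part.get_mem (h n (by omega)), rfl⟩⟩

theorem mem_of_mem_minStack {I : BStr →. ℕ} {σ : BStr} {n i k : ℕ} {l : List (BStr × ℕ)}
    (hl : l ∈ minStack I σ n) (hi : i < n) (hk : k ∈ I (σ.take i))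
    (hmin : ∀ j, i < j → j < n → ∀ k' ∈ I (σ.take j), k < k') : (σ.take i, k) ∈ l := by
  induction n generalizing l with
  | zero => omega
  | succ n ih =>
    obtain ⟨l', hl', k', hk', rfl⟩ := mem_minStack_succ.1 hl
    rcases Nat.lt_succ_iff_lt_or_eq.1 hi with hin | rfl
    · refine List.mem_cons_of_mem _ (List.mem_filter.2 ⟨?_, ?_⟩)
      · exact ih hl' hin fun j hj hj' => hmin j hj (by omega)
      · simpa using hmin n hin (by omega) k' hk'
    · rw [Part.mem_unique hk hk']
      exact List.mem_cons_self

/-! ### Kraft sums -/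

theorem exists_avoiding (N : ℕ) (S : Finset BStr) (hS : ∑ σ ∈ S, (1 / 2 : ℝ) ^ σ.length < 1) :
    ∃ y : BStr, y.length = N ∧ ∀ σ ∈ S, ¬ σ <+: y := by
  induction N generalizing S with
  | zero =>
    refine ⟨[], rfl, fun σ hσ h => ?_⟩
    obtain rfl := List.prefix_nil.1 h
    have := Finset.single_le_sum (f := fun σ : BStr => (1 / 2 : ℝ) ^ σ.length)
      (fun _ _ => by positivity) hσ
    simp only [List.length_nil, pow_zero] at this
    linarith
  | succ N ih =>
    classical
    have hnil : ([] : BStr) ∉ S := fun h => by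
      have := Finset.single_le_sum (f := fun σ : BStr => (1 / 2 : ℝ) ^ σ.length)
        (fun _ _ => by positivity) h
      simp only [List.length_nil, pow_zero] at this
      linarith
    let T : Bool → Finset BStr := fun b =>
      S.preimage (List.cons b) (List.cons_injective.injOn)
    have hT : ∀ b σ, σ ∈ T b ↔ b :: σ ∈ S := fun b σ => Finset.mem_preimage
    have hsum : ∑ b, ∑ σ ∈ T b, (1 / 2 : ℝ) ^ (σ.length + 1) ≤
        ∑ σ ∈ S, (1 / 2 : ℝ) ^ σ.length := by
      rw [Finset.sum_sigma' Finset.univ T fun _ σ => (1 / 2 : ℝ) ^ (σ.length + 1)]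
      refine (Finset.sum_image (s := Finset.univ.sigma T)
        (g := fun p : (_ : Bool) × BStr => p.1 :: p.2)
        (f := fun σ => (1 / 2 : ℝ) ^ σ.length) ?_).symm.le.trans ?_
      rotate_left
      · refine Finset.sum_le_sum_of_subset_of_nonneg (fun σ hσ => ?_) fun _ _ _ => by positivity
        obtain ⟨p, hp, rfl⟩ := Finset.mem_image.1 hσ
        exact (hT _ _).1 (Finset.mem_sigma.1 hp).2
      · rintro ⟨b, σ⟩ - ⟨b', σ'⟩ - h
        obtain ⟨rfl, rfl⟩ := List.cons.inj h
        rfl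
    obtain ⟨b, hb⟩ : ∃ b, ∑ σ ∈ T b, (1 / 2 : ℝ) ^ σ.length < 1 := by
      by_contra! h
      have h1 := h true
      have h2 := h false
      simp only [pow_succ, ← Finset.sum_mul, Fintype.sum_bool] at hsum
      linarith
    obtain ⟨y, hy, hav⟩ := ih (T b) hb
    refine ⟨b :: y, by simp [hy], fun σ hσ h => ?_⟩
    rcases σ with _ | ⟨b', σ⟩
    · exact hnil hσ
    · obtain ⟨rfl, hp⟩ := List.cons_prefix_cons.1 h
      exact hav σ ((hT _ _).2 hσ) hp

theorem PrefixFreeSet.uniquelyDecodable {S : Set BStr} (hS : PrefixFreeSet S) (hnil : [] ∉ S) :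
    InformationTheory.UniquelyDecodable S := by
  intro L₁
  induction L₁ with
  | nil =>
    intro L₂ _ h₂ h
    rcases L₂ with _ | ⟨w, L₂⟩
    · rfl
    · obtain ⟨rfl, -⟩ := List.append_eq_nil_iff.1 (List.flatten_cons ▸ h.symm)
      exact absurd (h₂ _ List.mem_cons_self) hnil
  | cons v L₁ ih =>
    intro L₂ h₁ h₂ h
    rcases L₂ with _ | ⟨w, L₂⟩
    · obtain ⟨rfl, -⟩ := List.append_eq_nil_iff.1 (List.flatten_cons ▸ h)
      exact absurd (h₁ _ List.mem_cons_self) hnil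
    · rw [List.flatten_cons, List.flatten_cons] at h
      have hv := h₁ v List.mem_cons_self
      have hw := h₂ w List.mem_cons_self
      have hvw : v = w := by
        rcases List.prefix_or_prefix_of_prefix (List.prefix_append v L₁.flatten)
          (h ▸ List.prefix_append w L₂.flatten) with hp | hp
        · exact hS v hv w hw hp
        · exact (hS w hw v hv hp).symm
      subst hvw
      rw [ih L₂ (fun u hu => h₁ u (List.mem_cons_of_mem _ hu))
        (fun u hu => h₂ u (List.mem_cons_of_mem _ hu)) (List.append_cancel_left h)]

theorem PrefixFreeSet.kraft {S : Finset BStr} (hS : PrefixFreeSet (S : Set BStr)) :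
    ∑ σ ∈ S, (1 / 2 : ℝ) ^ σ.length ≤ 1 := by
  by_cases hnil : ([] : BStr) ∈ S
  · have : S = {[]} := by
      refine Finset.eq_singleton_iff_unique_mem.2 ⟨hnil, fun σ hσ => ?_⟩
      exact (hS [] hnil σ hσ List.nil_prefix).symm
    simp [this]
  · simpa using InformationTheory.kraft_mcmillan_inequality
      (hS.uniquelyDecodable (by simpa using hnil))

/-! ### Invariants of the construction -/

/-- The invariants maintained by `codeStep`. -/
structure CodeInv (I : BStr →. ℕ) (c N : ℕ) (B : List BStr) (f : List (BStr × BStr)) : Prop where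
  length_le : ∀ q ∈ f, q.1.length ≤ N
  length_eq : ∀ q ∈ f, ∃ k ∈ I q.2, q.1.length = c + k
  unique : ∀ q ∈ f, ∀ q' ∈ f, q.1 = q'.1 → q.2 = q'.2
  chain : ∀ q ∈ f, ∀ l ∈ minChain I q.2, ∀ p ∈ l, (q.1.take (c + p.2), p.1) ∈ f
  open_unique : ∀ q ∈ f, ∀ q' ∈ f, q.2 = q'.2 → IsOpenCode f B N q.1 → IsOpenCode f B N q'.1 →
    q.1 = q'.1

theorem IsOpenCode.anti {f f' : List (BStr × BStr)} {B B' : List BStr} {N N' : ℕ} {ρ : BStr}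
    (h : IsOpenCode f' B' N' ρ) (hf : f ⊆ f') (hB : B ⊆ B') (hN : N ≤ N') (hρ : ρ.length ≤ N) :
    IsOpenCode f B N ρ := by
  obtain ⟨y, hy, hρy, hyB, hyf⟩ := h
  rw [mem_strs] at hy
  refine ⟨y.take N, mem_strs.2 (by simp [hy, hN]), ?_, fun b hb h => ?_, fun q hq h => ?_⟩
  · exact List.prefix_take_iff.2 ⟨hρy, hρ⟩
  · exact hyB b (hB hb) (h.trans (List.take_prefix _ _))
  · exact hyf q (hf hq) (h.trans (List.take_prefix _ _))

section
variable {I : BStr →. ℕ} {c N : ℕ} {B : List BStr} {f : List (BStr × BStr)}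

theorem CodeInv.mono {N' : ℕ} {B' : List BStr} (h : CodeInv I c N B f) (hN : N ≤ N')
    (hB : B ⊆ B') : CodeInv I c N' B' f where
  length_le q hq := (h.length_le q hq).trans hN
  length_eq := h.length_eq
  unique := h.unique
  chain := h.chain
  open_unique q hq q' hq' e ho ho' := h.open_unique q hq q' hq' e
    (ho.anti (List.Subset.refl _) hB hN (h.length_le q hq))
    (ho'.anti (List.Subset.refl _) hB hN (h.length_le q' hq'))

theorem CodeInv.extend {l : List (BStr × ℕ)} {y : BStr} (h : CodeInv I c N B f)
    (hl : IsMinChain I l) (hyN : y.length = N) (hy : ValidCode c N B l f y) :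
    CodeInv I c N B ((l.map fun p => (y.take (c + p.2), p.1)) ++ f) := by
  have hlen : ∀ p ∈ l, (y.take (c + p.2)).length = c + p.2 := fun p hp => by
    rw [List.length_take, hyN, min_eq_left (hy.2 p hp).1]
  have hinj : ∀ p ∈ l, ∀ q ∈ l, p.2 = q.2 → p = q := fun p hp q hq e => by
    by_contra hne
    have hsymm : Std.Symm fun p q : BStr × ℕ => p.2 ≠ q.2 := ⟨fun _ _ h => h.symm⟩
    exact (hl.pairwise.imp (S := fun p q => p.2 ≠ q.2) fun h => h.ne').forall hp hq hne e
  have hmem : ∀ q, q ∈ (l.map fun p => (y.take (c + p.2), p.1)) ++ f ↔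
      (∃ p ∈ l, (y.take (c + p.2), p.1) = q) ∨ q ∈ f := fun q => by
    rw [List.mem_append, List.mem_map]
  have hanti : ∀ ρ : BStr, ρ.length ≤ N →
      IsOpenCode ((l.map fun p => (y.take (c + p.2), p.1)) ++ f) B N ρ → IsOpenCode f B N ρ :=
    fun ρ hρ ho => ho.anti (List.subset_append_right _ _) (List.Subset.refl _) le_rfl hρ
  refine ⟨?_, ?_, ?_, ?_, ?_⟩
  · intro q hq
    rcases (hmem q).1 hq with ⟨p, hp, rfl⟩ | hq
    · exact (hlen p hp).trans_le (hy.2 p hp).1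
    · exact h.length_le q hq
  · intro q hq
    rcases (hmem q).1 hq with ⟨p, hp, rfl⟩ | hq
    · exact ⟨p.2, hl.mem p hp, hlen p hp⟩
    · exact h.length_eq q hq
  · have key : ∀ p ∈ l, ∀ q ∈ f, y.take (c + p.2) = q.1 → p.1 = q.2 := by
      intro p hp q hq e
      rcases (hy.2 p hp).2 with hf | ⟨hf, -⟩
      · exact h.unique _ hf q hq e
      · exact absurd e.symm (hf q hq)
    intro q hq q' hq' e
    rcases (hmem q).1 hq with ⟨p, hp, rfl⟩ | hq <;> rcases (hmem q').1 hq' with ⟨p', hp', rfl⟩ | hq'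
    · have := congrArg List.length e
      simp only [hlen p hp, hlen p' hp'] at this
      rw [hinj p hp p' hp' (by omega)]
    · exact key p hp q' hq' e
    · exact (key p' hp' q hq e.symm).symm
    · exact h.unique q hq q' hq' e
  · intro q hq l' hl' p' hp'
    rw [hmem]
    rcases (hmem q).1 hq with ⟨p, hp, rfl⟩ | hq
    · left
      obtain ⟨s, t, rfl⟩ := List.append_of_mem hp
      obtain rfl := Part.mem_unique hl' (hl.suffix p t (List.suffix_append s _))
      have hle : p'.2 ≤ p.2 := by
        rcases List.mem_cons.1 hp' with rfl | hpt
        · exact le_rfl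
        · exact (List.rel_of_pairwise_cons (List.pairwise_append.1 hl.pairwise).2.1 hpt).le
      refine ⟨p', List.mem_append_right _ hp', ?_⟩
      rw [List.take_take, min_eq_left (by omega)]
    · exact Or.inr (h.chain q hq l' hl' p' hp')
  · have key : ∀ p ∈ l, ∀ q ∈ f, p.1 = q.2 →
        IsOpenCode f B N (y.take (c + p.2)) → IsOpenCode f B N q.1 → y.take (c + p.2) = q.1 := by
      intro p hp q hq e ho ho'
      rcases (hy.2 p hp).2 with hf | ⟨-, hf⟩
      · exact h.open_unique _ hf q hq e ho ho'
      · exact absurd ho' (hf q hq e.symm)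
    have hle : ∀ p ∈ l, (y.take (c + p.2)).length ≤ N := fun p hp =>
      (hlen p hp).trans_le (hy.2 p hp).1
    intro q hq q' hq' e ho ho'
    rcases (hmem q).1 hq with ⟨p, hp, rfl⟩ | hq <;> rcases (hmem q').1 hq' with ⟨p', hp', rfl⟩ | hq'
    · have h1 := hl.mem p hp
      have h2 := hl.mem p' hp'
      rw [show p.1 = p'.1 from e] at h1
      rw [Part.mem_unique h1 h2]
    · exact key p hp q' hq' e (hanti _ (hle p hp) ho) (hanti _ (h.length_le q' hq') ho')
    · exact (key p' hp' q hq e.symm (hanti _ (hle p' hp') ho')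
        (hanti _ (h.length_le q hq) ho)).symm
    · exact h.open_unique q hq q' hq' e (hanti _ (h.length_le q hq) ho)
        (hanti _ (h.length_le q' hq') ho')

theorem codeStep_cases (c N : ℕ) (B : List BStr) (l : List (BStr × ℕ)) (f : List (BStr × BStr)) :
    (codeStep c N B l f = f ∧ ∀ y ∈ strs N, ¬ ValidCode c N B l f y) ∨
      ∃ y ∈ strs N, ValidCode c N B l f y ∧
        codeStep c N B l f = (l.map fun p => (y.take (c + p.2), p.1)) ++ f := by
  classical
  unfold codeStep
  rcases hL : (strs N).filter fun y => ValidCode c N B l f y with _ | ⟨y, L⟩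
  · left
    refine ⟨by simp, fun y hy hv => ?_⟩
    have : y ∈ (strs N).filter fun y => ValidCode c N B l f y :=
      List.mem_filter.2 ⟨hy, by simpa using hv⟩
    rw [hL] at this
    simp at this
  · right
    have : y ∈ (strs N).filter fun y => ValidCode c N B l f y := by
      rw [hL]
      exact List.mem_cons_self
    obtain ⟨hy, hv⟩ := List.mem_filter.1 this
    exact ⟨y, hy, by simpa using hv, by simp⟩

theorem CodeInv.codeStep {l : List (BStr × ℕ)} (h : CodeInv I c N B f) (hl : IsMinChain I l) :
    CodeInv I c N B (codeStep c N B l f) := by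
  rcases codeStep_cases c N B l f with ⟨e, -⟩ | ⟨y, hy, hv, e⟩
  · rwa [e]
  · rw [e]
    exact h.extend hl (mem_strs.1 hy) hv

/-- If the weights of `I` and of `B` are small, some string avoids both `B` and all codes. -/
theorem CodeInv.exists_free (h : CodeInv I c N B f)
    (hB : ∑ b ∈ B.toFinset, (1 / 2 : ℝ) ^ b.length ≤ 1 / 2)
    (hI : ∀ (A : Finset BStr) (k : BStr → ℕ), (∀ a ∈ A, k a ∈ I a) →
      ∑ a ∈ A, (1 / 2 : ℝ) ^ (c + k a) < 1 / 2) :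
    ∃ y ∈ strs N, (∀ b ∈ B, ¬ b <+: y) ∧ ∀ q ∈ f, ¬ q.1 <+: y := by
  classical
  let O := (f.map Prod.fst).toFinset.filter fun ρ => IsOpenCode f B N ρ
  have hO : ∀ ρ ∈ O, ∃ a, (ρ, a) ∈ f := fun ρ hρ => by
    obtain ⟨q, hq, rfl⟩ := List.mem_map.1 (List.mem_toFinset.1 (Finset.mem_filter.1 hρ).1)
    exact ⟨q.2, hq⟩
  choose! g hg using hO
  have hginj : Set.InjOn g O := fun ρ hρ ρ' hρ' e =>
    h.open_unique _ (hg ρ hρ) _ (hg ρ' hρ') e (Finset.mem_filter.1 hρ).2 (Finset.mem_filter.1 hρ').2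
  have hk : ∀ a ∈ O.image g, ∃ k, k ∈ I a := fun a ha => by
    obtain ⟨ρ, hρ, rfl⟩ := Finset.mem_image.1 ha
    obtain ⟨k, hk, -⟩ := h.length_eq _ (hg ρ hρ)
    exact ⟨k, hk⟩
  choose! k hk using hk
  have hsum : ∑ ρ ∈ O, (1 / 2 : ℝ) ^ ρ.length < 1 / 2 := by
    refine lt_of_eq_of_lt ?_ (hI (O.image g) k hk)
    rw [Finset.sum_image hginj]
    refine Finset.sum_congr rfl fun ρ hρ => ?_
    obtain ⟨k', hk', e⟩ := h.length_eq _ (hg ρ hρ)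
    rw [Part.mem_unique (hk _ (Finset.mem_image_of_mem g hρ)) hk', ← e]
  obtain ⟨y, hyN, hy⟩ := exists_avoiding N (O ∪ B.toFinset) (by
    have := Finset.sum_union_inter (s₁ := O) (s₂ := B.toFinset)
      (f := fun σ : BStr => (1 / 2 : ℝ) ^ σ.length)
    have h0 : 0 ≤ ∑ σ ∈ O ∩ B.toFinset, (1 / 2 : ℝ) ^ σ.length :=
      Finset.sum_nonneg fun _ _ => by positivity
    linarith)
  have hyB : ∀ b ∈ B, ¬ b <+: y := fun b hb =>
    hy b (Finset.mem_union_right _ (List.mem_toFinset.2 hb))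
  refine ⟨y, mem_strs.2 hyN, hyB, fun q hq hqy => ?_⟩
  obtain ⟨q', hq', hmax⟩ := (f.toFinset.filter fun q => q.1 <+: y).exists_max_image
    (fun q => q.1.length) ⟨q, by simpa using ⟨hq, hqy⟩⟩
  simp only [Finset.mem_filter, List.mem_toFinset] at hq' hmax
  refine hy q'.1 (Finset.mem_union_left _ (Finset.mem_filter.2 ⟨?_, ?_⟩)) hq'.2
  · exact List.mem_toFinset.2 (List.mem_map_of_mem hq'.1)
  · exact ⟨y, mem_strs.2 hyN, hq'.2, hyB, fun q hq hqy => hmax q ⟨hq, hqy⟩⟩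

theorem List.forall_not_or_exists_first {α : Type*} (P : α → Prop) (l : List α) :
    (∀ p ∈ l, ¬ P p) ∨ ∃ s p t, l = s ++ p :: t ∧ P p ∧ ∀ q ∈ s, ¬ P q := by
  induction l with
  | nil => simp
  | cons a l ih =>
    by_cases ha : P a
    · exact Or.inr ⟨[], a, l, rfl, ha, by simp⟩
    · rcases ih with h | ⟨s, p, t, rfl, hp, hs⟩
      · exact Or.inl (by simpa [ha] using h)
      · exact Or.inr ⟨a :: s, p, t, rfl, hp, by simpa [ha] using hs⟩

theorem CodeInv.exists_valid {l : List (BStr × ℕ)} (h : CodeInv I c N B f) (hl : IsMinChain I l)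
    (hN : ∀ p ∈ l, c + p.2 ≤ N)
    (hB : ∑ b ∈ B.toFinset, (1 / 2 : ℝ) ^ b.length ≤ 1 / 2)
    (hI : ∀ (A : Finset BStr) (k : BStr → ℕ), (∀ a ∈ A, k a ∈ I a) →
      ∑ a ∈ A, (1 / 2 : ℝ) ^ (c + k a) < 1 / 2) :
    ∃ y ∈ strs N, ValidCode c N B l f y := by
  rcases List.forall_not_or_exists_first
    (fun p : BStr × ℕ => ∃ q ∈ f, q.2 = p.1 ∧ IsOpenCode f B N q.1) l with
    hno | ⟨s, p, t, rfl, ⟨q, hq, hqp, ho⟩, hs⟩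
  · obtain ⟨y, hy, hyB, hyf⟩ := h.exists_free hB hI
    refine ⟨y, hy, hyB, fun p hp => ⟨hN p hp, Or.inr ⟨fun q hq e => ?_, fun q hq e ho => ?_⟩⟩⟩
    · exact hyf q hq (e ▸ List.take_prefix _ _)
    · exact hno p hp ⟨q, hq, e, ho⟩
  · obtain ⟨y, hy, hqy, hyB, hyf⟩ := ho
    have hpw := List.pairwise_append.1 hl.pairwise
    have hp : p ∈ s ++ p :: t := List.mem_append_right _ List.mem_cons_self
    have hqlen : q.1.length = c + p.2 := by
      obtain ⟨k, hk, e⟩ := h.length_eq q hq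
      rw [hqp] at hk
      rw [e, Part.mem_unique hk (hl.mem p hp)]
    refine ⟨y, hy, hyB, fun p' hp' => ⟨hN p' hp', ?_⟩⟩
    rcases List.mem_append.1 hp' with hp's | hp't
    · refine Or.inr ⟨fun q' hq' e => ?_, fun q' hq' e ho => hs p' hp's ⟨q', hq', e, ho⟩⟩
      have h1 := hyf q' hq' (e ▸ List.take_prefix _ _)
      have h2 := hpw.2.2 p' hp's p List.mem_cons_self
      rw [e, List.length_take, mem_strs.1 hy, min_eq_left (hN p' hp')] at h1
      omega
    · left
      have h1 := h.chain q hq (p :: t)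
        (by rw [hqp]; exact hl.suffix p t (List.suffix_append s _)) p' hp't
      have hle : p'.2 ≤ p.2 := by
        rcases List.mem_cons.1 hp't with rfl | hpt
        · exact le_rfl
        · exact (List.rel_of_pairwise_cons hpw.2.1 hpt).le
      rwa [List.prefix_iff_eq_take.1 hqy, List.take_take, min_eq_left (by omega)] at h1

end

/-! ### The construction -/

/-- The elements enumerated by `b` before stage `s`. -/
def enumBefore (b : ℕ → Option BStr) (s : ℕ) : List BStr := (List.range s).filterMap b

/-- The pairs (code, string) produced before stage `s`, where `e` enumerates the chains to be coded
and `b` the strings to be avoided. -/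
noncomputable def codes (c : ℕ) (b : ℕ → Option BStr) (e : ℕ → Option (List (BStr × ℕ))) :
    ℕ → List (BStr × BStr)
  | 0 => []
  | s + 1 => codeStep c s (enumBefore b s) ((e s).getD []) (codes c b e s)

theorem mem_enumBefore {b : ℕ → Option BStr} {s : ℕ} {σ : BStr} :
    σ ∈ enumBefore b s ↔ ∃ t < s, b t = some σ := by
  simp [enumBefore]

theorem enumBefore_subset {b : ℕ → Option BStr} {s t : ℕ} (h : s ≤ t) :
    enumBefore b s ⊆ enumBefore b t := fun σ hσ => by
  rw [mem_enumBefore] at hσ ⊢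
  obtain ⟨u, hu, e⟩ := hσ
  exact ⟨u, hu.trans_le h, e⟩

theorem primrec_codes {c : ℕ} {b : ℕ → Option BStr} {e : ℕ → Option (List (BStr × ℕ))}
    (hb : Primrec b) (he : Primrec e) : Primrec (codes c b e) := by
  have hstep : Primrec₂ fun (s : ℕ) (f : List (BStr × BStr)) =>
      codeStep c s (enumBefore b s) ((e s).getD []) f := by
    have hB : Primrec (enumBefore b) :=
      Primrec.listFilterMap Primrec.list_range (hb.comp Primrec.snd)
    have hE : Primrec fun s => (e s).getD [] := Primrec.option_getD.comp he (Primrec.const _)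
    exact (primrec_codeStep c).comp (((hE.comp Primrec.fst).pair Primrec.snd).pair
      ((hB.comp Primrec.fst).pair Primrec.fst))
  refine (Primrec.nat_rec₁ [] hstep).of_eq fun s => ?_
  induction s with
  | zero => rfl
  | succ s ih => simp only [ih, codes]

theorem codes_subset_succ (c : ℕ) (b : ℕ → Option BStr) (e : ℕ → Option (List (BStr × ℕ)))
    (s : ℕ) : codes c b e s ⊆ codes c b e (s + 1) :=
  List.subset_append_right _ _

theorem codes_subset {c : ℕ} {b : ℕ → Option BStr} {e : ℕ → Option (List (BStr × ℕ))}
    {s t : ℕ} (h : s ≤ t) : codes c b e s ⊆ codes c b e t := by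
  induction h with
  | refl => exact List.Subset.refl _
  | step _ ih => exact List.Subset.trans ih (codes_subset_succ c b e _)

theorem codeInv_codes {I : BStr →. ℕ} {c : ℕ} {b : ℕ → Option BStr}
    {e : ℕ → Option (List (BStr × ℕ))} (he : ∀ s l, l ∈ e s → ∃ σ, l ∈ minChain I σ) (s : ℕ) :
    CodeInv I c s (enumBefore b s) (codes c b e s) := by
  induction s with
  | zero => exact ⟨by simp [codes], by simp [codes], by simp [codes], by simp [codes],
      by simp [codes]⟩
  | succ s ih =>
    refine (ih.codeStep ?_).mono s.le_succ (enumBefore_subset s.le_succ)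
    rcases hs : e s with _ | l
    · exact ⟨by simp, by simp, by simp⟩
    · obtain ⟨σ, hσ⟩ := he s l hs
      exact isMinChain_of_mem_minChain hσ

/-- Every string with a chain is coded, at arbitrarily late stages, along a string that avoids
everything enumerated so far by `b`. -/
theorem exists_code_avoiding {I : BStr →. ℕ} {c : ℕ} {b : ℕ → Option BStr}
    {e : ℕ → Option (List (BStr × ℕ))} (he : ∀ s l, l ∈ e s → ∃ σ, l ∈ minChain I σ)
    (hB : ∀ s, ∑ σ ∈ (enumBefore b s).toFinset, (1 / 2 : ℝ) ^ σ.length ≤ 1 / 2)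
    (hI : ∀ (A : Finset BStr) (k : BStr → ℕ), (∀ a ∈ A, k a ∈ I a) →
      ∑ a ∈ A, (1 / 2 : ℝ) ^ (c + k a) < 1 / 2)
    {l : List (BStr × ℕ)} (hl : ∀ M, ∃ s, M ≤ s ∧ l ∈ e s) (M : ℕ) :
    ∃ y : BStr, M ≤ y.length ∧ (∀ σ ∈ enumBefore b M, ¬ σ <+: y) ∧
      ∀ p ∈ l, c + p.2 ≤ y.length ∧ ∃ s, (y.take (c + p.2), p.1) ∈ codes c b e s := by
  obtain ⟨s, hMs, hs⟩ := hl (M + (l.map fun p => c + p.2).sum)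
  obtain ⟨σ, hσ⟩ := he s l hs
  have hN : ∀ p ∈ l, c + p.2 ≤ s := fun p hp =>
    (List.le_sum_of_mem (List.mem_map_of_mem (f := fun p : BStr × ℕ => c + p.2) hp)).trans
      (by omega)
  obtain ⟨y₀, hy₀, hv₀⟩ := (codeInv_codes (c := c) (b := b) he s).exists_valid
    (isMinChain_of_mem_minChain hσ) hN (hB s) hI
  rcases codeStep_cases c s (enumBefore b s) l (codes c b e s) with ⟨-, h⟩ | ⟨y, hy, hv, h⟩
  · exact absurd hv₀ (h y₀ hy₀)
  · rw [mem_strs] at hy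
    refine ⟨y, by omega, fun σ hσ => hv.1 σ (enumBefore_subset (by omega) hσ), fun p hp =>
      ⟨(hN p hp).trans hy.ge, s + 1, ?_⟩⟩
    rw [Option.mem_def] at hs
    rw [codes, hs, Option.getD_some, h]
    exact List.mem_append_left _ (List.mem_map_of_mem (f := fun p : BStr × ℕ =>
      (y.take (c + p.2), p.1)) hp)

/-! ### Streams -/

theorem length_stake (X : ℕ → Bool) (n : ℕ) : (stake X n).length = n := by simp [stake]

theorem take_stake (X : ℕ → Bool) {i n : ℕ} (h : i ≤ n) : (stake X n).take i = stake X i := by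
  simp [stake, ← List.map_take, List.take_range, min_eq_left h]

theorem stake_getD (y : BStr) {n : ℕ} (h : n ≤ y.length) :
    stake (fun i => y.getD i false) n = y.take n := by
  refine List.ext_getElem (by simp [stake, h]) fun i h₁ h₂ => ?_
  rw [length_stake] at h₁
  simp [stake, List.getD_eq_getElem?_getD, List.getElem?_eq_getElem (h₁.trans_le h)]

theorem isClosed_stake (n : ℕ) (P : BStr → Prop) : IsClosed {Y : ℕ → Bool | P (stake Y n)} := by
  have hc : Continuous fun (Y : ℕ → Bool) (i : Fin n) => Y i := by fun_prop
  have := (isClosed_discrete {z : Fin n → Bool | P (List.ofFn z)}).preimage hc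
  convert this using 1
  ext Y
  have : stake Y n = List.ofFn fun i : Fin n => Y i := by
    refine List.ext_getElem (by simp [stake]) fun i h₁ h₂ => by simp [stake]
  simp [this]

/-- Beyond every position a sequence with finite sublevel sets has a last minimum. -/
theorem exists_last_min {v : ℕ → ℕ} (hv : ∀ m, {i | v i ≤ m}.Finite) (n : ℕ) :
    ∃ i, n ≤ i ∧ (∀ j, n ≤ j → v i ≤ v j) ∧ ∀ j, i < j → v i < v j := by
  obtain ⟨i₀, hi₀, hmin⟩ := (measure v).wf.has_min (Set.Ici n) ⟨n, Set.self_mem_Ici⟩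
  have hmin' : ∀ j, n ≤ j → v i₀ ≤ v j := fun j hj => not_lt.1 (hmin j hj)
  obtain ⟨i, ⟨hi, hni⟩, hmax⟩ := ((hv (v i₀)).inter_of_left (Set.Ici n)).exists_maximalFor id _
    ⟨i₀, (le_rfl : v i₀ ≤ v i₀), hi₀⟩
  have e : v i = v i₀ := le_antisymm hi (hmin' i hni)
  refine ⟨i, hni, fun j hj => e ▸ hmin' j hj, fun j hj => ?_⟩
  by_contra! h
  have := hmax (j := j) ⟨h.trans e.le, (Set.mem_Ici.1 hni).trans hj.le⟩ hj.le
  exact absurd hj (not_lt.2 this)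

/-! ### Weights -/

theorem exists_weight_bound {I : BStr →. ℕ} (hsum : (∑' σ : BStr, iweight I σ) < ⊤) :
    ∃ c : ℕ, ∀ (A : Finset BStr) (k : BStr → ℕ), (∀ a ∈ A, k a ∈ I a) →
      ∑ a ∈ A, (1 / 2 : ℝ) ^ (c + k a) < 1 / 2 := by
  obtain ⟨c, hc⟩ := pow_unbounded_of_one_lt (2 * (∑' σ : BStr, iweight I σ).toReal) one_lt_two
  refine ⟨c, fun A k hk => ?_⟩
  have hw : ∀ a ∈ A, (iweight I a).toReal = (1 / 2 : ℝ) ^ k a := fun a ha => by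
    have hdom : (I a).Dom := Part.dom_iff_mem.2 ⟨_, hk a ha⟩
    rw [iweight, dif_pos hdom, Part.mem_unique (Part.get_mem hdom) (hk a ha)]
    simp
  have hle : ∑ a ∈ A, (1 / 2 : ℝ) ^ k a ≤ (∑' σ : BStr, iweight I σ).toReal := by
    rw [← Finset.sum_congr rfl hw, ← ENNReal.toReal_sum]
    · exact ENNReal.toReal_mono hsum.ne (ENNReal.sum_le_tsum A)
    · exact fun a _ => ((ENNReal.le_tsum a).trans_lt hsum).ne
  simp only [pow_add, ← Finset.mul_sum]
  have h2 : (1 / 2 : ℝ) ^ c * 2 ^ c = 1 := by rw [← mul_pow]; norm_num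
  have hpos : 0 < (1 / 2 : ℝ) ^ c := by positivity
  nlinarith

/-- `U` restricted to inputs shorter than their outputs. -/
def compressible (U : BStr →. BStr) (ρ : BStr) : Part BStr :=
  (U ρ).bind fun σ => ((if ρ.length < σ.length then some σ else none : Option BStr) : Part BStr)

theorem mem_compressible {U : BStr →. BStr} {ρ σ : BStr} :
    σ ∈ compressible U ρ ↔ σ ∈ U ρ ∧ ρ.length < σ.length := by
  unfold compressible
  rw [Part.mem_bind_iff]
  constructor
  · rintro ⟨τ, hτ, h⟩
    split_ifs at h with hlt
    · obtain rfl : σ = τ := by simpa using h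
      exact ⟨hτ, hlt⟩
    · simp at h
  · rintro ⟨h, hlt⟩
    exact ⟨σ, h, by simp [hlt]⟩

theorem partrec_compressible {U : BStr →. BStr} (hU : Partrec U) : Partrec (compressible U) := by
  refine hU.bind (Computable.ofOption (Primrec.to_comp ?_))
  exact Primrec.ite (Primrec.nat_lt.comp (Primrec.list_length.comp Primrec.fst)
    (Primrec.list_length.comp Primrec.snd)) (Primrec.option_some.comp Primrec.snd)
    (Primrec.const none)

theorem sum_compressible_le {U : BStr →. BStr} (hU : PrefixFreeSet {ρ | (U ρ).Dom})
    (T : Finset BStr) (hT : ∀ σ ∈ T, ∃ ρ, σ ∈ compressible U ρ) :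
    ∑ σ ∈ T, (1 / 2 : ℝ) ^ σ.length ≤ 1 / 2 := by
  classical
  choose! g hg using hT
  simp only [mem_compressible] at hg
  have hinj : Set.InjOn g T := fun σ hσ τ hτ e =>
    Part.mem_unique (hg σ hσ).1 (e ▸ (hg τ hτ).1)
  have hpf : PrefixFreeSet ((T.image g : Finset BStr) : Set BStr) := by
    have hdom : ∀ ρ ∈ ((T.image g : Finset BStr) : Set BStr), ρ ∈ {ρ | (U ρ).Dom} := by
      intro ρ hρ
      obtain ⟨σ, hσ, rfl⟩ := Finset.mem_image.1 (Finset.mem_coe.1 hρ)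
      exact Part.dom_iff_mem.2 ⟨σ, (hg σ hσ).1⟩
    exact fun ρ hρ τ hτ => hU ρ (hdom ρ hρ) τ (hdom τ hτ)
  have hk := hpf.kraft
  rw [Finset.sum_image hinj] at hk
  calc ∑ σ ∈ T, (1 / 2 : ℝ) ^ σ.length ≤ ∑ σ ∈ T, 1 / 2 * (1 / 2 : ℝ) ^ (g σ).length := by
        refine Finset.sum_le_sum fun σ hσ => ?_
        rw [← pow_succ']
        exact pow_le_pow_of_le_one (by norm_num) (by norm_num) (hg σ hσ).2
    _ ≤ 1 / 2 := by
        rw [← Finset.mul_sum]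
        linarith

/-! ### Randomness -/

/-- The self-delimiting code `0 … 0 1` of the number `n`. -/
def unaryWord (n : ℕ) : BStr := (List.range (n + 1)).map fun i => decide (i = n)

theorem length_unaryWord (n : ℕ) : (unaryWord n).length = n + 1 := by simp [unaryWord]

theorem primrec_unaryWord : Primrec unaryWord :=
  Primrec.list_map (Primrec.list_range.comp Primrec.succ)
    (Primrec.eq.comp Primrec.snd Primrec.fst).decide

theorem eq_of_unaryWord_prefixOf {m n : ℕ} (h : unaryWord m <+: unaryWord n) : m = n := by
  have hm : m < (unaryWord m).length := by simp [length_unaryWord]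
  have := h.getElem hm
  simpa [unaryWord] using this

/-- A prefix-free machine with every string in its range. -/
def unaryMachine (ρ : BStr) : Part BStr :=
  ((if ρ = unaryWord (ρ.length - 1) then Encodable.decode (ρ.length - 1) else none :
    Option BStr) : Part BStr)

theorem prefixFreeMachine_unaryMachine : PrefixFreeMachine unaryMachine := by
  constructor
  · have hn : Primrec fun ρ : BStr => ρ.length - 1 :=
      Primrec.nat_sub.comp Primrec.list_length (Primrec.const 1)
    exact (Primrec.ite (Primrec.eq.comp Primrec.id (primrec_unaryWord.comp hn))
      (Primrec.decode.comp hn) (Primrec.const none)).to_comp.ofOption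
  · have h : ∀ ρ, (unaryMachine ρ).Dom → ρ = unaryWord (ρ.length - 1) := fun ρ hρ => by
      by_contra hne
      simp [unaryMachine, hne] at hρ
    intro ρ hρ τ hτ hp
    rw [h ρ hρ, h τ hτ] at hp
    rw [h ρ hρ, h τ hτ, eq_of_unaryWord_prefixOf hp]

theorem UniversalPFM.exists_mem {U : BStr →. BStr} (hU : UniversalPFM U) (σ : BStr) :
    ∃ ρ, σ ∈ U ρ := by
  obtain ⟨c, hc⟩ := hU.2 _ prefixFreeMachine_unaryMachine
  by_contra! h
  have h1 : KM U σ = ⊤ := by simp [KM, h]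
  have h2 : KM unaryMachine σ ≤ (unaryWord (Encodable.encode σ)).length := by
    refine sInf_le ⟨_, ?_, rfl⟩
    simp [unaryMachine, length_unaryWord]
  have h3 := (hc σ).trans (add_le_add_left h2 _)
  rw [h1, top_le_iff] at h3
  exact absurd h3 (by exact_mod_cast ENat.natCast_ne_top _)

theorem UniversalPFM.exists_length_eq_Kof {U : BStr →. BStr} (hU : UniversalPFM U) (σ : BStr) :
    ∃ ρ, σ ∈ U ρ ∧ ρ.length = Kof U σ := by
  obtain ⟨ρ₀, hρ₀⟩ := hU.exists_mem σ
  obtain ⟨ρ, hρ, e⟩ : KM U σ ∈ (fun ρ : BStr => (ρ.length : ℕ∞)) '' {ρ | σ ∈ U ρ} :=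
    csInf_mem ⟨_, ρ₀, hρ₀, rfl⟩
  exact ⟨ρ, hρ, by rw [Kof, ← e]; rfl⟩

theorem UniversalPFM.mlRandom {U : BStr →. BStr} (hU : UniversalPFM U) {Y : ℕ → Bool}
    (hY : ∀ n ρ, stake Y n ∉ compressible U ρ) : MLRandom U Y := by
  refine ⟨0, fun n => ?_⟩
  obtain ⟨ρ, hρ, e⟩ := hU.exists_length_eq_Kof (stake Y n)
  by_contra! h
  exact hY n ρ (mem_compressible.2 ⟨hρ, by rw [length_stake]; omega⟩)

/-! ### Decoding -/

/-- Look for a string coded by `p.2` and return its first `p.1` bits. -/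
noncomputable def decodeWith (C : ℕ → List (BStr × BStr)) (p : ℕ × BStr) : Part BStr :=
  Nat.rfindOpt fun s => (@List.lookup _ _ instBEqOfDecidableEq p.2 (C s)).map fun σ => σ.take p.1

theorem partrec_decodeWith {C : ℕ → List (BStr × BStr)} (hC : Primrec C) :
    Partrec (decodeWith C) := by
  refine Partrec.rfindOpt (Primrec.to_comp ?_)
  exact Primrec.option_map (Primrec.listLookup.comp (Primrec.snd.comp Primrec.fst)
    (hC.comp Primrec.snd)) (Primrec.list_take.comp (Primrec.fst.comp (Primrec.fst.comp Primrec.fst))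
      Primrec.snd)

theorem mem_of_mem_lookup {α β : Type*} [DecidableEq α] {l : List (α × β)} {a : α} {b : β}
    (h : b ∈ l.lookup a) : (a, b) ∈ l := by
  obtain ⟨l₁, l₂, rfl, -⟩ := List.lookup_eq_some_iff.1 h
  simp

theorem exists_mem_lookup {α β : Type*} [DecidableEq α] {l : List (α × β)} {a : α} {b : β}
    (h : (a, b) ∈ l) : ∃ b', l.lookup a = some b' :=
  Option.isSome_iff_exists.1 (List.lookup_isSome_iff.2 ⟨_, h, by simp⟩)

theorem mem_decodeWith {C : ℕ → List (BStr × BStr)} {n : ℕ} {ρ σ : BStr}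
    (hC : ∀ s t σ τ, (ρ, σ) ∈ C s → (ρ, τ) ∈ C t → σ = τ) (h : ∃ s, (ρ, σ) ∈ C s) :
    σ.take n ∈ decodeWith C (n, ρ) := by
  obtain ⟨s, hs⟩ := h
  obtain ⟨τ, hτ⟩ := exists_mem_lookup hs
  have hdom : (decodeWith C (n, ρ)).Dom :=
    Nat.rfindOpt_dom.2 ⟨s, τ.take n, by simp [hτ]⟩
  obtain ⟨t, ht⟩ := Nat.rfindOpt_spec (Part.get_mem hdom)
  obtain ⟨τ', hτ', e⟩ := Option.mem_map.1 ht
  rw [hC s t σ τ' hs (mem_of_mem_lookup hτ'), e]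
  exact Part.get_mem hdom

/-- The compactness argument: a stream all of whose relevant prefixes are codes. -/
theorem exists_stream_codes {I : BStr →. ℕ} {c : ℕ} {b : ℕ → Option BStr}
    {e : ℕ → Option (List (BStr × ℕ))} (he : ∀ s l, l ∈ e s → ∃ σ, l ∈ minChain I σ)
    (he' : ∀ σ l, l ∈ minChain I σ → ∀ M, ∃ s, M ≤ s ∧ l ∈ e s)
    (hB : ∀ s, ∑ σ ∈ (enumBefore b s).toFinset, (1 / 2 : ℝ) ^ σ.length ≤ 1 / 2)
    (hI : ∀ (A : Finset BStr) (k : BStr → ℕ), (∀ a ∈ A, k a ∈ I a) →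
      ∑ a ∈ A, (1 / 2 : ℝ) ^ (c + k a) < 1 / 2)
    {X : ℕ → Bool} {v : ℕ → ℕ} (hv : ∀ i, v i ∈ I (stake X i))
    (hmin : ∀ n, ∃ i, n ≤ i ∧ ∀ j, i < j → v i < v j) :
    ∃ Y : ℕ → Bool, (∀ n s, stake Y n ∉ enumBefore b s) ∧
      ∀ i, (∀ j, i < j → v i < v j) →
        ∃ s, (stake Y (c + v i), stake X i) ∈ codes c b e s := by
  let C : ℕ → Set (ℕ → Bool) := fun M =>
    {Y | (∀ σ ∈ enumBefore b M, σ ≠ stake Y σ.length) ∧ ∀ i ≤ M, (∀ j, i < j → v i < v j) →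
      ∃ s, (stake Y (c + v i), stake X i) ∈ codes c b e s}
  have hne : ∀ M, (C M).Nonempty := by
    intro M
    obtain ⟨i₀, hi₀, htrue⟩ := hmin M
    have hI₀ : ∀ i ≤ i₀, (stake X i₀).take i = stake X i := fun i hi => take_stake X hi
    obtain ⟨l, hl⟩ : ∃ l, l ∈ minChain I (stake X i₀) := by
      refine minStack_dom fun i hi => ?_
      rw [length_stake] at hi
      rw [hI₀ i (by omega)]
      exact Part.dom_iff_mem.2 ⟨_, hv i⟩
    obtain ⟨y, hMy, hyB, hyl⟩ := exists_code_avoiding he hB hI (he' _ l hl)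
      (M + ((enumBefore b M).map List.length).sum)
    refine ⟨fun i => y.getD i false, fun σ hσ e => ?_, fun i hi hti => ?_⟩
    · have hlen : σ.length ≤ y.length := (List.le_sum_of_mem (List.mem_map_of_mem hσ)).trans
        (by omega)
      rw [stake_getD y hlen] at e
      exact hyB σ (enumBefore_subset (by omega) hσ) (List.prefix_iff_eq_take.2 e)
    · have hmem : ((stake X i₀).take i, v i) ∈ l := by
        refine mem_of_mem_minStack hl (by rw [length_stake]; omega) ?_ fun j hj hj' k' hk' => ?_
        · rw [hI₀ i (by omega)]
          exact hv i
        · rw [length_stake] at hj'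
          rw [hI₀ j (by omega)] at hk'
          rw [Part.mem_unique hk' (hv j)]
          exact hti j hj
      rw [hI₀ i (by omega)] at hmem
      obtain ⟨hlen, s, hs⟩ := hyl _ hmem
      exact ⟨s, by rwa [stake_getD y hlen]⟩
  have hcl : ∀ M, IsClosed (C M) := by
    intro M
    have h1 : IsClosed {Y : ℕ → Bool | ∀ σ ∈ enumBefore b M, σ ≠ stake Y σ.length} := by
      simp only [Set.ofPred_forall]
      exact isClosed_iInter fun σ => isClosed_iInter fun _ => isClosed_stake _ fun τ => σ ≠ τ
    have h2 : IsClosed {Y : ℕ → Bool | ∀ i ≤ M, (∀ j, i < j → v i < v j) →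
        ∃ s, (stake Y (c + v i), stake X i) ∈ codes c b e s} := by
      simp only [Set.ofPred_forall]
      exact isClosed_iInter fun i => isClosed_iInter fun _ => isClosed_iInter fun _ =>
        isClosed_stake _ fun τ => ∃ s, (τ, stake X i) ∈ codes c b e s
    exact h1.inter h2
  have hanti : ∀ M, C (M + 1) ⊆ C M := fun M Y hY =>
    ⟨fun σ hσ => hY.1 σ (enumBefore_subset M.le_succ hσ), fun i hi => hY.2 i (by omega)⟩
  obtain ⟨Y, hY⟩ := IsCompact.nonempty_iInter_of_sequence_nonempty_isCompact_isClosed C hanti hne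
    (hcl 0).isCompact hcl
  rw [Set.mem_iInter] at hY
  refine ⟨Y, fun n s hn => (hY s).1 _ hn ?_, fun i => (hY i).2 i le_rfl⟩
  rw [length_stake]

/-- Theorem: uniform version of the coding theorem. For every partial computable
information content measure `I` there are a constant `c` and a single partial computable
`F` decoding every `X` (on whose prefixes `I` is defined) from a Martin-Löf random `Y`
with oracle-use `c + min_{i ≥ n} I(X↾i)`. -/
theorem stmt1 (U : BStr →. BStr) (hU : UniversalPFM U)
    (I : BStr →. ℕ) (hI : Partrec I) (hsum : (∑' σ : BStr, iweight I σ) < ⊤) :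
    ∃ c : ℕ, ∃ F : ℕ × BStr →. BStr, Partrec F ∧
      ∀ X : ℕ → Bool, (∀ n, (I (stake X n)).Dom) →
        ∃ Y : ℕ → Bool, MLRandom U Y ∧
          ∀ n, stake X n ∈
            F (n, stake Y (c + sInf {m : ℕ | ∃ i, n ≤ i ∧ m ∈ I (stake X i)})) := by
  obtain ⟨c, hc⟩ := exists_weight_bound hsum
  obtain ⟨e, he, he₁, he₂⟩ := (partrec_minChain hI).exists_enum
  obtain ⟨b, hb, hb₁, hb₂⟩ := (partrec_compressible hU.1.1).exists_enum
  have hB : ∀ s, ∑ σ ∈ (enumBefore b s).toFinset, (1 / 2 : ℝ) ^ σ.length ≤ 1 / 2 := fun s => by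
    refine sum_compressible_le hU.1.2 _ fun σ hσ => ?_
    obtain ⟨t, -, ht⟩ := mem_enumBefore.1 (List.mem_toFinset.1 hσ)
    exact hb₁ t σ ht
  refine ⟨c, decodeWith (codes c b e), partrec_decodeWith (primrec_codes hb he), fun X hX => ?_⟩
  choose v hv using fun n => Part.dom_iff_mem.1 (hX n)
  have hinj : Function.Injective (stake X) := fun m n h => by
    simpa [length_stake] using congrArg List.length h
  have hfin : ∀ m, {i | v i ≤ m}.Finite := fun m => by
    by_contra hinf
    obtain ⟨A, hA, hcard⟩ := Set.Infinite.exists_subset_card_eq hinf (2 ^ (c + m))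
    have := hc (A.image (stake X)) (fun σ => v σ.length) fun a ha => by
      obtain ⟨i, -, rfl⟩ := Finset.mem_image.1 ha
      rw [length_stake]
      exact hv i
    rw [Finset.sum_image hinj.injOn] at this
    have h1 : ∑ _i ∈ A, (1 / 2 : ℝ) ^ (c + m) ≤
        ∑ i ∈ A, (1 / 2 : ℝ) ^ (c + v (stake X i).length) := by
      refine Finset.sum_le_sum fun i hi => ?_
      rw [length_stake]
      exact pow_le_pow_of_le_one (by norm_num) (by norm_num)
        (Nat.add_le_add_left (hA hi) c)
    rw [Finset.sum_const, hcard, nsmul_eq_mul, Nat.cast_pow, ← mul_pow] at h1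
    norm_num at h1
    linarith
  obtain ⟨Y, hYb, hYc⟩ := exists_stream_codes he₁ he₂ hB hc hv fun n => by
    obtain ⟨i, hi, -, h⟩ := exists_last_min hfin n
    exact ⟨i, hi, h⟩
  refine ⟨Y, hU.mlRandom fun n ρ h => ?_, fun n => ?_⟩
  · obtain ⟨s, -, hs⟩ := hb₂ ρ _ h 0
    exact hYb n (s + 1) (mem_enumBefore.2 ⟨s, s.lt_succ_self, hs⟩)
  · obtain ⟨i, hni, hle, hlt⟩ := exists_last_min hfin n
    have hInf : sInf {m : ℕ | ∃ i, n ≤ i ∧ m ∈ I (stake X i)} = v i := by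
      refine IsLeast.csInf_eq ⟨⟨i, hni, hv i⟩, ?_⟩
      rintro m ⟨j, hj, hm⟩
      rw [Part.mem_unique hm (hv j)]
      exact hle j hj
    rw [hInf, ← take_stake X hni]
    refine mem_decodeWith (fun s t σ τ hσ hτ => ?_) (hYc i hlt)
    exact (codeInv_codes he₁ (max s t)).unique _ (codes_subset (le_max_left s t) hσ) _
      (codes_subset (le_max_right s t) hτ) rfl
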